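/- Let (A, ∘, ω) be a pseudo-Hessian pre-Lie algebra over a field K and let r = Σᵢ aᵢ⊗bᵢ ∈ A⊗A be a symmetric solution of the S-equation in (A, ∘). Let Δ_r(x) = Σᵢ (x∘aᵢ⊗bᵢ + aᵢ⊗x∘bᵢ − aᵢ⊗bᵢ∘x). Assume moreover that ω is a (symmetric) solution of the co-S-equation in the pre-Lie coalgebra (A, Δ_r). Then the linear map N : A → A defined by N(x) = Σᵢ ω(x, aᵢ) bᵢ is a Nijenhuis operator on (A, ∘), i.e., N(x)∘N(y) + N²(x∘y) = N(N(x)∘y) + N(x∘N(y)) for all x, y ∈ A. -/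

import Mathlib

open TensorProduct LinearMap

noncomputable section

section Defs

variable (K A : Type*) [Field K] [AddCommGroup A] [Module K A]

/-- The flip map on `A ⊗ A`. -/
def flipT : A ⊗[K] A →ₗ[K] A ⊗[K] A := (TensorProduct.comm K A A).toLinearMap

/-- Swap the first two tensor factors of `A ⊗ (A ⊗ A)`. -/
def swap12 : A ⊗[K] (A ⊗[K] A) →ₗ[K] A ⊗[K] (A ⊗[K] A) :=
  (TensorProduct.assoc K A A A).toLinearMap ∘ₗ
    (TensorProduct.map (flipT K A) LinearMap.id) ∘ₗ
      (TensorProduct.assoc K A A A).symm.toLinearMap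

/-- Cyclic permutation `a ⊗ b ⊗ c ↦ c ⊗ a ⊗ b` on `A ⊗ (A ⊗ A)`. -/
def cyc : A ⊗[K] (A ⊗[K] A) →ₗ[K] A ⊗[K] (A ⊗[K] A) :=
  (TensorProduct.comm K (A ⊗[K] A) A).toLinearMap ∘ₗ
    (TensorProduct.assoc K A A A).symm.toLinearMap

variable {K A}

/-- `coassoc1 Δ δ x = x₍₁₎₍₁'₎ ⊗ x₍₁₎₍₂'₎ ⊗ x₍₂₎`, applying `δ` to the first Sweedler leg of `Δ`. -/
def coassoc1 (Δ δ : A →ₗ[K] A ⊗[K] A) : A →ₗ[K] A ⊗[K] (A ⊗[K] A) :=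
  (TensorProduct.assoc K A A A).toLinearMap ∘ₗ (TensorProduct.map δ LinearMap.id) ∘ₗ Δ

/-- `coassoc2 Δ δ x = x₍₁₎ ⊗ x₍₂₎₍₁'₎ ⊗ x₍₂₎₍₂'₎`, applying `δ` to the second Sweedler leg of `Δ`. -/
def coassoc2 (Δ δ : A →ₗ[K] A ⊗[K] A) : A →ₗ[K] A ⊗[K] (A ⊗[K] A) :=
  (TensorProduct.map LinearMap.id δ) ∘ₗ Δ

/-- The (left) pre-Lie identity for a bilinear multiplication. -/
def IsPreLie (m : A →ₗ[K] A →ₗ[K] A) : Prop :=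
  ∀ x y z : A, m (m x y) z - m x (m y z) = m (m y x) z - m y (m x z)

/-- The pre-Lie coalgebra identity for a comultiplication. -/
def IsPreLieCo (Δ : A →ₗ[K] A ⊗[K] A) : Prop :=
  ∀ x : A, coassoc1 Δ Δ x - coassoc2 Δ Δ x
    = swap12 K A (coassoc1 Δ Δ x) - swap12 K A (coassoc2 Δ Δ x)

/-- Equation (2.2) of a pre-Lie bialgebra. -/
def BialgEq1 (m : A →ₗ[K] A →ₗ[K] A) (Δ : A →ₗ[K] A ⊗[K] A) : Prop :=
  ∀ x y : A, Δ (m x y) - Δ (m y x)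
    = rTensor A (m x) (Δ y) + lTensor A (m x) (Δ y) - lTensor A (m.flip x) (Δ y)
      - rTensor A (m y) (Δ x) - lTensor A (m y) (Δ x) + lTensor A (m.flip y) (Δ x)

/-- Equation (2.3) of a pre-Lie bialgebra. -/
def BialgEq2 (m : A →ₗ[K] A →ₗ[K] A) (Δ : A →ₗ[K] A ⊗[K] A) : Prop :=
  ∀ x y : A, Δ (m x y) - flipT K A (Δ (m x y))
    = lTensor A (m.flip y) (Δ x) + lTensor A (m x) (Δ y)
      - flipT K A (rTensor A (m x) (Δ y)) - flipT K A (lTensor A (m.flip y) (Δ x))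
      - flipT K A (lTensor A (m x) (Δ y)) + rTensor A (m x) (Δ y)

/-- `(A, m, Δ)` is a pre-Lie bialgebra. -/
def IsPreLieBialg (m : A →ₗ[K] A →ₗ[K] A) (Δ : A →ₗ[K] A ⊗[K] A) : Prop :=
  IsPreLie m ∧ IsPreLieCo Δ ∧ BialgEq1 m Δ ∧ BialgEq2 m Δ

/-- The linear form on `A ⊗ A` given by `u ⊗ v ↦ f u * g v`. -/
def pairForm (f g : A →ₗ[K] K) : A ⊗[K] A →ₗ[K] K :=
  TensorProduct.lift ((LinearMap.mul K K).compl₁₂ f g)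

/-- The co-S-equation for a bilinear form `ω` on a pre-Lie coalgebra `(A, Δ)`. -/
def IsCoSEq (Δ : A →ₗ[K] A ⊗[K] A) (ω : A →ₗ[K] A →ₗ[K] K) : Prop :=
  ∀ x y z : A,
    pairForm (ω x) (ω.flip z) (Δ y) + pairForm (ω x) (ω y) (Δ z)
      = pairForm (ω.flip y) (ω.flip z) (Δ x) + pairForm (ω y) (ω x) (Δ z)

/-- The multiplication `x ∘_ω y = x₍₁₎ ω(x₍₂₎, y) + y₍₁₎ ω(x, y₍₂₎) − ω(x, y₍₁₎) y₍₂₎`. -/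
def omul (Δ : A →ₗ[K] A ⊗[K] A) (ω : A →ₗ[K] A →ₗ[K] K) : A →ₗ[K] A →ₗ[K] A :=
  TensorProduct.lift ((LinearMap.smulRightₗ ∘ₗ ω).flip) ∘ₗ Δ
  + (TensorProduct.lift ((LinearMap.smulRightₗ ∘ₗ ω.flip).flip) ∘ₗ Δ).flip
  - (TensorProduct.lift (LinearMap.smulRightₗ ∘ₗ ω.flip) ∘ₗ Δ).flip

/-- `N` is a Nijenhuis operator on the (pre-)Lie algebra `(A, m)`. -/
def IsNijenhuis (m : A →ₗ[K] A →ₗ[K] A) (N : A →ₗ[K] A) : Prop :=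
  ∀ x y : A, m (N x) (N y) + N (N (m x y)) = N (m (N x) y) + N (m x (N y))

/-- `S` is a Nijenhuis operator on the (pre-)Lie coalgebra `(A, Δ)`. -/
def IsNijenhuisCo (Δ : A →ₗ[K] A ⊗[K] A) (S : A →ₗ[K] A) : Prop :=
  ∀ x : A, TensorProduct.map S S (Δ x) + Δ (S (S x))
    = rTensor A S (Δ (S x)) + lTensor A S (Δ (S x))

/-- The 2-cocycle (pseudo-Hessian) condition for a bilinear form on a pre-Lie algebra. -/
def IsHessian (m : A →ₗ[K] A →ₗ[K] A) (ω : A →ₗ[K] A →ₗ[K] K) : Prop :=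
  ∀ x y z : A, ω (m x y) z - ω x (m y z) = ω (m y x) z - ω y (m x z)

/-- The multiplication `A ⊗ A →ₗ A` induced by a bilinear multiplication. -/
def mhat (m : A →ₗ[K] A →ₗ[K] A) : A ⊗[K] A →ₗ[K] A := TensorProduct.lift m

variable (K A) in
/-- The middle-four exchange `(a ⊗ b) ⊗ (c ⊗ d) ↦ (a ⊗ c) ⊗ (b ⊗ d)` as a linear map. -/
def ttc : (A ⊗[K] A) ⊗[K] (A ⊗[K] A) →ₗ[K] (A ⊗[K] A) ⊗[K] (A ⊗[K] A) :=
  (TensorProduct.tensorTensorTensorComm K A A A A).toLinearMap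

/-- `(aᵢ ⊗ bᵢ) ⊗ (aⱼ ⊗ bⱼ) ↦ aᵢ ⊗ (bᵢ∘aⱼ) ⊗ bⱼ`. -/
def sTerm1 (m : A →ₗ[K] A →ₗ[K] A) :
    (A ⊗[K] A) ⊗[K] (A ⊗[K] A) →ₗ[K] A ⊗[K] (A ⊗[K] A) :=
  lTensor A (rTensor A (mhat m)) ∘ₗ
    lTensor A (TensorProduct.assoc K A A A).symm.toLinearMap ∘ₗ
      (TensorProduct.assoc K A A (A ⊗[K] A)).toLinearMap

/-- `(aᵢ ⊗ bᵢ) ⊗ (aⱼ ⊗ bⱼ) ↦ aᵢ ⊗ aⱼ ⊗ (bᵢ∘bⱼ)`. -/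
def sTerm2 (m : A →ₗ[K] A →ₗ[K] A) :
    (A ⊗[K] A) ⊗[K] (A ⊗[K] A) →ₗ[K] A ⊗[K] (A ⊗[K] A) :=
  lTensor A (lTensor A (mhat m) ∘ₗ swap12 K A) ∘ₗ
    (TensorProduct.assoc K A A (A ⊗[K] A)).toLinearMap

/-- `(aᵢ ⊗ bᵢ) ⊗ (aⱼ ⊗ bⱼ) ↦ (aᵢ∘aⱼ) ⊗ bᵢ ⊗ bⱼ`. -/
def sTerm3 (m : A →ₗ[K] A →ₗ[K] A) :
    (A ⊗[K] A) ⊗[K] (A ⊗[K] A) →ₗ[K] A ⊗[K] (A ⊗[K] A) :=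
  rTensor (A ⊗[K] A) (mhat m) ∘ₗ ttc K A

/-- `(aᵢ ⊗ bᵢ) ⊗ (aⱼ ⊗ bⱼ) ↦ aᵢ ⊗ aⱼ ⊗ (bⱼ∘bᵢ)`. -/
def sTerm4 (m : A →ₗ[K] A →ₗ[K] A) :
    (A ⊗[K] A) ⊗[K] (A ⊗[K] A) →ₗ[K] A ⊗[K] (A ⊗[K] A) :=
  lTensor A (lTensor A (mhat m ∘ₗ flipT K A)) ∘ₗ
    (TensorProduct.assoc K A A (A ⊗[K] A)).toLinearMap ∘ₗ ttc K A

/-- `r` is a solution of the S-equation in the pre-Lie algebra `(A, m)`. -/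
def IsSEq (m : A →ₗ[K] A →ₗ[K] A) (r : A ⊗[K] A) : Prop :=
  sTerm1 m (r ⊗ₜ[K] r) + sTerm2 m (r ⊗ₜ[K] r)
    = sTerm3 m (r ⊗ₜ[K] r) + sTerm4 m (r ⊗ₜ[K] r)

/-- The comultiplication `Δ_r(x) = x∘aᵢ ⊗ bᵢ + aᵢ ⊗ x∘bᵢ − aᵢ ⊗ bᵢ∘x`. -/
def coprodR (m : A →ₗ[K] A →ₗ[K] A) (r : A ⊗[K] A) : A →ₗ[K] A ⊗[K] A :=
  (rTensorHom (M := A) ∘ₗ m).flip r + (lTensorHom (M := A) ∘ₗ m).flip r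
    - (lTensorHom (M := A) ∘ₗ m.flip).flip r

/-- The Nijenhuis pre-Lie algebra `((A, m), N)` is `S`-admissible. -/
def IsAdmissible (m : A →ₗ[K] A →ₗ[K] A) (N S : A →ₗ[K] A) : Prop :=
  (∀ x y : A, S (m (N x) y) + m x (S (S y)) = m (N x) (S y) + S (m x (S y))) ∧
  (∀ x y : A, S (m x (N y)) + m (S (S x)) y = m (S x) (N y) + S (m (S x) y))

/-- `((A*, Δ*), S*)` is `N*`-admissible, written on `A`. -/
def IsCoAdmissible (Δ : A →ₗ[K] A ⊗[K] A) (N S : A →ₗ[K] A) : Prop :=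
  (∀ x : A, lTensor A S (Δ (N x)) + rTensor A (N ∘ₗ N) (Δ x)
      = TensorProduct.map N S (Δ x) + rTensor A N (Δ (N x))) ∧
  (∀ x : A, rTensor A S (Δ (N x)) + lTensor A (N ∘ₗ N) (Δ x)
      = TensorProduct.map S N (Δ x) + lTensor A N (Δ (N x)))

/-- `(A, m, Δ, N, S)` is a Nijenhuis pre-Lie bialgebra. -/
def IsNijPreLieBialg (m : A →ₗ[K] A →ₗ[K] A) (Δ : A →ₗ[K] A ⊗[K] A)
    (N S : A →ₗ[K] A) : Prop :=
  IsPreLie m ∧ IsNijenhuis m N ∧ IsPreLieCo Δ ∧ IsNijenhuisCo Δ S ∧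
    BialgEq1 m Δ ∧ BialgEq2 m Δ ∧ IsAdmissible m N S ∧ IsCoAdmissible Δ N S

/-- The pre-Lie bialgebra `(A, m, Δ)` is balanced. -/
def IsBalanced (m : A →ₗ[K] A →ₗ[K] A) (Δ : A →ₗ[K] A ⊗[K] A) : Prop :=
  ∀ x y : A, rTensor A (m.flip y) (Δ x) + flipT K A (rTensor A (m.flip x) (Δ y))
    = rTensor A (m.flip x) (Δ y) + flipT K A (rTensor A (m.flip y) (Δ x))

/-- `(A, b)` is a Lie algebra. -/
def IsLieBracket (b : A →ₗ[K] A →ₗ[K] A) : Prop :=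
  (∀ x : A, b x x = 0) ∧
  (∀ x y z : A, b (b x y) z + b (b y z) x + b (b z x) y = 0)

/-- `(A, d)` is a Lie coalgebra. -/
def IsLieCobracket (d : A →ₗ[K] A ⊗[K] A) : Prop :=
  (∀ x : A, d x = - flipT K A (d x)) ∧
  (∀ x : A, coassoc2 d d x + cyc K A (coassoc2 d d x) + cyc K A (cyc K A (coassoc2 d d x)) = 0)

/-- `(A, b, d)` is a Lie bialgebra. -/
def IsLieBialg (b : A →ₗ[K] A →ₗ[K] A) (d : A →ₗ[K] A ⊗[K] A) : Prop :=
  IsLieBracket b ∧ IsLieCobracket d ∧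
    ∀ x y : A, d (b x y)
      = rTensor A (b x) (d y) + lTensor A (b x) (d y)
        - rTensor A (b y) (d x) - lTensor A (b y) (d x)

/-- `(A, b, d, N, S)` is a Nijenhuis Lie bialgebra. -/
def IsNijLieBialg (b : A →ₗ[K] A →ₗ[K] A) (d : A →ₗ[K] A ⊗[K] A)
    (N S : A →ₗ[K] A) : Prop :=
  IsLieBialg b d ∧ IsNijenhuis b N ∧ IsNijenhuisCo d S ∧
  (∀ x y : A, S (b (N x) y) + b x (S (S y)) = b (N x) (S y) + S (b x (S y))) ∧
  (∀ x : A, rTensor A S (d (N x)) + lTensor A (N ∘ₗ N) (d x)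
      = TensorProduct.map S N (d x) + lTensor A N (d (N x)))

/-- The map `r♯ : A* → A`, `r♯(f) = Σ f(aᵢ) bᵢ`. -/
def rsharp (r : A ⊗[K] A) (f : A →ₗ[K] K) : A :=
  TensorProduct.lift (LinearMap.lsmul K A ∘ₗ f) r

/-- The map `N : A → A`, `N(x) = Σ ω(x, aᵢ) bᵢ`. -/
def hessNij (ω : A →ₗ[K] A →ₗ[K] K) (r : A ⊗[K] A) : A →ₗ[K] A :=
  TensorProduct.lift (LinearMap.smulRightₗ ∘ₗ ω.flip) r

/-- The map `S : A → A`, `S(x) = Σ aᵢ ω(bᵢ, x)`. -/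
def coNij (ω : A →ₗ[K] A →ₗ[K] K) (r : A ⊗[K] A) : A →ₗ[K] A :=
  TensorProduct.lift ((LinearMap.smulRightₗ ∘ₗ ω).flip) r

end Defs

section Rep

variable {K A V H : Type*} [Field K] [AddCommGroup A] [Module K A]
  [AddCommGroup V] [Module K V] [AddCommGroup H] [Module K H]

/-- `(V, ρ, φ)` is a representation of the pre-Lie algebra `(A, m)`. -/
def IsRep (m : A →ₗ[K] A →ₗ[K] A) (ρ φ : A →ₗ[K] V →ₗ[K] V) : Prop :=
  (∀ (x y : A) (v : V), ρ (m x y - m y x) v = ρ x (ρ y v) - ρ y (ρ x v)) ∧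
  (∀ (x y : A) (v : V), φ (m x y) v = ρ x (φ y v) - φ y (ρ x v) + φ y (φ x v))

/-- The `α`-conditions making `((V, ρ, φ), α)` a representation of `((A, m), N)`. -/
def IsNijRep (m : A →ₗ[K] A →ₗ[K] A) (N : A →ₗ[K] A) (ρ φ : A →ₗ[K] V →ₗ[K] V)
    (α : V →ₗ[K] V) : Prop :=
  (∀ (x : A) (v : V), ρ (N x) (α v) + α (α (ρ x v)) = α (ρ (N x) v) + α (ρ x (α v))) ∧
  (∀ (x : A) (v : V), φ (N x) (α v) + α (α (φ x v)) = α (φ (N x) v) + α (φ x (α v)))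

/-- The semidirect product multiplication on `A ⊕ V`:
`(x+u) ∘ (y+v) = x∘y + ρ(x)v + φ(y)u`. -/
def semidirectMul (m : A →ₗ[K] A →ₗ[K] A) (ρ φ : A →ₗ[K] V →ₗ[K] V) :
    (A × V) →ₗ[K] (A × V) →ₗ[K] (A × V) :=
  (m.compl₁₂ (fst K A V) (fst K A V)).compr₂ (inl K A V)
  + (ρ.compl₁₂ (fst K A V) (snd K A V)).compr₂ (inr K A V)
  + ((φ.compl₁₂ (fst K A V) (snd K A V)).compr₂ (inr K A V)).flip

/-- The bicrossed product multiplication on `A ⊕ H`: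
`(x+a) ∘ (y+b) = x∘y + ρ_H(a)y + φ_H(b)x + a∘b + ρ_A(x)b + φ_A(y)a`. -/
def matchedMul (mA : A →ₗ[K] A →ₗ[K] A) (mH : H →ₗ[K] H →ₗ[K] H)
    (ρA φA : A →ₗ[K] H →ₗ[K] H) (ρH φH : H →ₗ[K] A →ₗ[K] A) :
    (A × H) →ₗ[K] (A × H) →ₗ[K] (A × H) :=
  (mA.compl₁₂ (fst K A H) (fst K A H)).compr₂ (inl K A H)
  + (ρH.compl₁₂ (snd K A H) (fst K A H)).compr₂ (inl K A H)
  + ((φH.compl₁₂ (snd K A H) (fst K A H)).compr₂ (inl K A H)).flip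
  + (mH.compl₁₂ (snd K A H) (snd K A H)).compr₂ (inr K A H)
  + (ρA.compl₁₂ (fst K A H) (snd K A H)).compr₂ (inr K A H)
  + ((φA.compl₁₂ (fst K A H) (snd K A H)).compr₂ (inr K A H)).flip

/-- Equations (3.5)–(3.8) of a matched pair of pre-Lie algebras. -/
def MatchedPairEqs (mA : A →ₗ[K] A →ₗ[K] A) (mH : H →ₗ[K] H →ₗ[K] H)
    (ρA φA : A →ₗ[K] H →ₗ[K] H) (ρH φH : H →ₗ[K] A →ₗ[K] A) : Prop :=
  (∀ (x : A) (a b : H), ρA x (mH a b)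
      = -(ρA (ρH a x - φH a x) b) + mH (ρA x a - φA x a) b + φA (φH b x) a + mH a (ρA x b)) ∧
  (∀ (x : A) (a b : H), φA x (mH a b - mH b a)
      = φA (ρH b x) a - φA (ρH a x) b + mH a (φA x b) - mH b (φA x a)) ∧
  (∀ (a : H) (x y : A), ρH a (mA x y)
      = -(ρH (ρA x a - φA x a) y) + mA (ρH a x - φH a x) y + φH (φA y a) x + mA x (ρH a y)) ∧
  (∀ (a : H) (x y : A), φH a (mA x y - mA y x)
      = φH (ρA y a) x - φH (ρA x a) y + mA x (φH a y) - mA y (φH a x))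

/-- The (negative) dual action `x ↦ ρ*(x)`, `⟨ρ*(x)v*, v⟩ = −⟨v*, ρ(x)v⟩`. -/
def negTranspose (ρ : A →ₗ[K] V →ₗ[K] V) :
    A →ₗ[K] (V →ₗ[K] K) →ₗ[K] (V →ₗ[K] K) :=
  Module.Dual.transpose (R := K) ∘ₗ (-ρ)

end Rep

set_option synthInstance.maxHeartbeats 1000000
set_option maxHeartbeats 1000000

section Helpers

variable {K A : Type*} [Field K] [AddCommGroup A] [Module K A]

lemma rsharp_zero (f : A →ₗ[K] K) : rsharp (0 : A ⊗[K] A) f = 0 := by simp [rsharp]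

lemma rsharp_tmul (a b : A) (f : A →ₗ[K] K) : rsharp (a ⊗ₜ[K] b) f = f a • b := by
  simp [rsharp]

lemma rsharp_add (r s : A ⊗[K] A) (f : A →ₗ[K] K) :
    rsharp (r + s) f = rsharp r f + rsharp s f := by simp [rsharp]

lemma rsharp_fadd (r : A ⊗[K] A) (f g : A →ₗ[K] K) :
    rsharp r (f + g) = rsharp r f + rsharp r g := by
  induction r with
  | zero => simp [rsharp_zero]
  | tmul a b => simp [rsharp_tmul, add_smul]
  | add r s hr hs => simp only [rsharp_add, hr, hs]; abel

lemma rsharp_fsub (r : A ⊗[K] A) (f g : A →ₗ[K] K) :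
    rsharp r (f - g) = rsharp r f - rsharp r g := by
  have := rsharp_fadd r (f - g) g
  rw [sub_add_cancel] at this
  rw [this, add_sub_cancel_right]

lemma flipT_tmul (a b : A) : flipT K A (a ⊗ₜ[K] b) = b ⊗ₜ[K] a := by simp [flipT]

lemma apply_rsharp (r : A ⊗[K] A) (f g : A →ₗ[K] K) :
    g (rsharp r f) = f (rsharp (flipT K A r) g) := by
  induction r with
  | zero => simp [rsharp_zero]
  | tmul a b => simp [rsharp_tmul, flipT_tmul, mul_comm]
  | add r s hr hs => simp only [rsharp_add, map_add, hr, hs]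

lemma hessNij_eq (ω : A →ₗ[K] A →ₗ[K] K) (r : A ⊗[K] A) (x : A) :
    hessNij ω r x = rsharp r (ω x) := by
  induction r with
  | zero => simp [rsharp_zero, hessNij]
  | tmul a b => simp [rsharp_tmul, hessNij]
  | add r s hr hs =>
    rw [rsharp_add, ← hr, ← hs]
    simp [hessNij]

lemma pairForm_tmul (f g : A →ₗ[K] K) (a b : A) : pairForm f g (a ⊗ₜ[K] b) = f a * g b := by
  simp [pairForm]

lemma pairForm_coprodR (m : A →ₗ[K] A →ₗ[K] A) (f g : A →ₗ[K] K) (r : A ⊗[K] A) (x : A) :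
    pairForm f g (coprodR m r x) = f (m x (rsharp (flipT K A r) g)) + g (m x (rsharp r f))
      - g (m (rsharp r f) x) := by
  induction r with
  | zero => simp [rsharp_zero, coprodR]
  | tmul a b =>
    simp [rsharp_tmul, flipT_tmul, pairForm_tmul, coprodR, mul_comm]
  | add r s hr hs =>
    have h : coprodR m (r + s) x = coprodR m r x + coprodR m s x := by
      simp only [coprodR, map_add, LinearMap.add_apply, LinearMap.sub_apply]; abel
    rw [h, map_add, hr, hs]
    simp only [rsharp_add, map_add, LinearMap.add_apply]; ring

/-- `a ⊗ b ⊗ c ↦ f a • h c • b`. -/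
def midForm (f h : A →ₗ[K] K) : A ⊗[K] (A ⊗[K] A) →ₗ[K] A :=
  TensorProduct.lift (LinearMap.lsmul K A ∘ₗ f) ∘ₗ
    lTensor A (TensorProduct.lift (LinearMap.lsmul K A ∘ₗ h) ∘ₗ flipT K A)

lemma midForm_tmul (f h : A →ₗ[K] K) (a b c : A) :
    midForm f h (a ⊗ₜ[K] (b ⊗ₜ[K] c)) = f a • h c • b := by
  simp [midForm, flipT_tmul, smul_smul, mul_comm]

lemma mid1 (m : A →ₗ[K] A →ₗ[K] A) (f h : A →ₗ[K] K) (r s : A ⊗[K] A) :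
    midForm f h (sTerm1 m (r ⊗ₜ[K] s)) = m (rsharp r f) (rsharp (flipT K A s) h) := by
  induction r with
  | zero => simp [rsharp_zero]
  | add r r' hr hr' => simp only [add_tmul, map_add, rsharp_add, LinearMap.add_apply, hr, hr']
  | tmul a b =>
    induction s with
    | zero => simp [rsharp_zero]
    | add r r' hr hr' => simp only [tmul_add, map_add, rsharp_add, hr, hr']
    | tmul c d => simp [sTerm1, mhat, midForm_tmul, rsharp_tmul, flipT_tmul, smul_smul, mul_comm]

lemma mid2 (m : A →ₗ[K] A →ₗ[K] A) (f h : A →ₗ[K] K) (r s : A ⊗[K] A) :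
    midForm f h (sTerm2 m (r ⊗ₜ[K] s)) = rsharp (flipT K A s) (h ∘ₗ m (rsharp r f)) := by
  induction s with
  | zero => simp [rsharp_zero]
  | add r r' hr hr' => simp only [tmul_add, map_add, rsharp_add, hr, hr']
  | tmul c d =>
    induction r with
    | zero => simp [rsharp_zero, rsharp_tmul, flipT_tmul]
    | add r r' hr hr' =>
      simp only [add_tmul, map_add, rsharp_add, hr, hr', LinearMap.comp_add, rsharp_fadd]
    | tmul a b =>
      simp [sTerm2, swap12, mhat, midForm_tmul, rsharp_tmul, flipT_tmul, smul_smul]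

lemma mid3 (m : A →ₗ[K] A →ₗ[K] A) (f h : A →ₗ[K] K) (r s : A ⊗[K] A) :
    midForm f h (sTerm3 m (r ⊗ₜ[K] s)) = rsharp r (f ∘ₗ m.flip (rsharp (flipT K A s) h)) := by
  induction r with
  | zero => simp [rsharp_zero]
  | add r r' hr hr' => simp only [add_tmul, map_add, rsharp_add, hr, hr']
  | tmul a b =>
    induction s with
    | zero => simp [rsharp_zero, rsharp_tmul]
    | add r r' hr hr' =>
      simp only [tmul_add, map_add, rsharp_add, hr, hr', LinearMap.comp_add, rsharp_fadd]
    | tmul c d =>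
      simp [sTerm3, ttc, mhat, midForm_tmul, rsharp_tmul, flipT_tmul, smul_smul, mul_comm]

lemma mid4 (m : A →ₗ[K] A →ₗ[K] A) (f h : A →ₗ[K] K) (r s : A ⊗[K] A) :
    midForm f h (sTerm4 m (r ⊗ₜ[K] s)) = rsharp (flipT K A s) (h ∘ₗ m.flip (rsharp r f)) := by
  induction s with
  | zero => simp [rsharp_zero]
  | add r r' hr hr' => simp only [tmul_add, map_add, rsharp_add, hr, hr']
  | tmul c d =>
    induction r with
    | zero => simp [rsharp_zero, rsharp_tmul, flipT_tmul]
    | add r r' hr hr' =>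
      simp only [add_tmul, map_add, rsharp_add, hr, hr', LinearMap.comp_add, rsharp_fadd]
    | tmul a b =>
      simp [sTerm4, ttc, mhat, midForm_tmul, rsharp_tmul, flipT_tmul, smul_smul]

end Helpers

section Theorems

variable {K A V H : Type*} [Field K] [AddCommGroup A] [Module K A]
  [AddCommGroup V] [Module K V] [AddCommGroup H] [Module K H]

theorem nijenhuis_from_pseudoHessian
    (m : A →ₗ[K] A →ₗ[K] A) (ω : A →ₗ[K] A →ₗ[K] K)
    (hm : IsPreLie m) (hsym : ∀ x y : A, ω x y = ω y x) (hHess : IsHessian m ω)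
    (r : A ⊗[K] A) (hr : flipT K A r = r) (hS : IsSEq m r)
    (hω : IsCoSEq (coprodR m r) ω) :
    IsNijenhuis m (hessNij ω r) := by
  intro x y
  have hflip : ω.flip = ω := by
    ext u v; simp [hsym v u]
  have hN := hessNij_eq ω r
  have hadj : ∀ u v, ω u (hessNij ω r v) = ω (hessNij ω r u) v := by
    intro u v
    rw [hN, hN, apply_rsharp, hr, hsym v]
  have h1 := congrArg (midForm (ω x) (ω y)) hS
  rw [map_add, map_add, mid1, mid2, mid3, mid4, hr, ← hN, ← hN] at h1
  have h2 : ω x ∘ₗ m.flip (hessNij ω r y) + ω y ∘ₗ m.flip (hessNij ω r x)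
      - ω y ∘ₗ m (hessNij ω r x)
      = ω (m (hessNij ω r x) y) + ω (m x (hessNij ω r y)) - ω (hessNij ω r (m x y)) := by
    ext z
    have hc := hω x z y
    simp only [pairForm_coprodR, hflip, hr, ← hN] at hc
    have hh := hHess x (hessNij ω r z) y
    have e := hadj (m x y) z
    simp only [LinearMap.add_apply, LinearMap.sub_apply, LinearMap.comp_apply,
      LinearMap.flip_apply]
    rw [hsym (m (hessNij ω r x) y) z, hsym (m x (hessNij ω r y)) z]
    rw [hsym (m x (hessNij ω r z)) y, hsym (m (hessNij ω r z) x) y,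
      hsym (hessNij ω r z)] at hh
    linear_combination hc + hh - e
  have h3 := congrArg (rsharp r) h2
  simp only [rsharp_fadd, rsharp_fsub, ← hN] at h3
  have h4 := eq_sub_of_add_eq h1
  rw [h4, add_sub_assoc, ← add_sub_assoc, h3]
  abel

end Theorems
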